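/- There exists a constant C > 0 (depending only on the normalization of μ) such that for every integer m ≥ 2, every compact subset Ω ⊂ G, and every γ ∈ G with |Tr(γ)| < 2 − 1/√m, one has ∫_Ω cosh( H(g⁻¹γg)/2 )^{−2m} dμ(g) ≤ C·( log(m)/√m + μ(Ω)/m ). (The integrand equals |Φ_m(g⁻¹γg)|, where Φ_m is the weight-m spherical function with Casimir eigenvalue m(1−m), given by Φ_m(k a_t k') = χ_m(kk')·cosh(t/2)^{−2m}.) -/

import Mathlib

open Matrix MatrixGroups MeasureTheory

/-- `SL(2,ℝ)` carries the subspace topology from the space of `2 × 2` real matrices. -/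
instance : TopologicalSpace SL(2, ℝ) := instTopologicalSpaceSubtype

/-- The displacement `H(g) = dist(g·i, i)` of the point `i` of the upper half-plane under
`g ∈ SL(2,ℝ)`, where `dist` is the hyperbolic distance. -/
noncomputable def Hdisp (g : SL(2, ℝ)) : ℝ :=
  dist (g • UpperHalfPlane.I) UpperHalfPlane.I

section

open UpperHalfPlane Set

/-- `SL(2,ℝ)` with the subspace topology is a topological group. -/
instance instIsTopologicalGroupSL2R : IsTopologicalGroup SL(2, ℝ) :=
  Matrix.SpecialLinearGroup.topologicalGroup

theorem isProperMap_orbit_I : IsProperMap fun g : SL(2, ℝ) ↦ g • I :=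
  UpperHalfPlane.isProperMap_smul_I

/-- The elements of `SL(2,ℝ)` moving `I` into the closed ball of radius `r` about `z`. -/
def orbitBall (z : ℍ) (r : ℝ) : Set SL(2, ℝ) := {g | dist (g • I) z ≤ r}

theorem isCompact_orbitBall (z : ℍ) (r : ℝ) : IsCompact (orbitBall z r) :=
  isProperMap_orbit_I.isCompact_preimage (isCompact_closedBall z r)

theorem orbitBall_mono (z : ℍ) {r s : ℝ} (h : r ≤ s) : orbitBall z r ⊆ orbitBall z s :=
  fun _ hg ↦ le_trans hg h

section Haar

variable [MeasurableSpace SL(2, ℝ)] [BorelSpace SL(2, ℝ)]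

theorem measurableSet_orbitBall (z : ℍ) (r : ℝ) : MeasurableSet (orbitBall z r) :=
  ((Metric.isClosed_closedBall (x := z) (ε := r)).preimage
    isProperMap_orbit_I.continuous).measurableSet

variable (μ : Measure SL(2, ℝ)) [μ.IsHaarMeasure]

theorem measure_orbitBall_eq (z : ℍ) (r : ℝ) : μ (orbitBall z r) = μ (orbitBall I r) := by
  obtain ⟨h, rfl⟩ := MulAction.exists_smul_eq SL(2, ℝ) I z
  rw [← measure_preimage_mul μ h⁻¹ (orbitBall I r)]
  congr 1
  ext g
  simp only [orbitBall, mem_ofPred_eq, mem_preimage, mul_smul]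
  rw [← dist_smul h (h⁻¹ • g • I) I, smul_inv_smul]

theorem measureReal_orbitBall_eq (z : ℍ) (r : ℝ) :
    μ.real (orbitBall z r) = μ.real (orbitBall I r) := by
  rw [Measure.real, measure_orbitBall_eq, Measure.real]

end Haar

/-- A square grid of points in `[0, 1] × [1, 2]` with mesh `6 r`. -/
noncomputable def gridPoint (r : ℝ) (hr : 0 < r) (p : ℕ × ℕ) : ℍ :=
  ⟨⟨6 * r * p.1, 1 + 6 * r * p.2⟩, by positivity⟩

@[simp] theorem gridPoint_re (r : ℝ) (hr : 0 < r) (p : ℕ × ℕ) :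
    (gridPoint r hr p).re = 6 * r * p.1 := rfl

@[simp] theorem gridPoint_im (r : ℝ) (hr : 0 < r) (p : ℕ × ℕ) :
    (gridPoint r hr p).im = 1 + 6 * r * p.2 := rfl

theorem cosh_dist_re_im (z w : ℍ) :
    Real.cosh (dist z w) = 1 + ((z.re - w.re) ^ 2 + (z.im - w.im) ^ 2) / (2 * z.im * w.im) := by
  rw [cosh_dist, Complex.dist_eq_re_im, Real.sq_sqrt (by positivity)]
  rfl

theorem euclidean_sq_le_of_dist_le {z w : ℍ} {r : ℝ} (hr : r ≤ 1 / 2) (h : dist z w ≤ 2 * r) :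
    (z.re - w.re) ^ 2 + (z.im - w.im) ^ 2 ≤ 8 * r ^ 2 * (z.im * w.im) := by
  have h2 : dist z w ^ 2 / 2 ≤ 2 * r ^ 2 := by
    nlinarith [pow_le_pow_left₀ (dist_nonneg (x := z) (y := w)) h 2]
  have h1 : Real.cosh (dist z w) ≤ Real.exp (2 * r ^ 2) :=
    (Real.cosh_le_exp_half_sq _).trans (Real.exp_le_exp.2 h2)
  have h0 : 0 ≤ 2 * r ^ 2 := by positivity
  have h3 := Real.abs_exp_sub_one_le (x := 2 * r ^ 2) (by rw [abs_of_nonneg h0]; nlinarith [dist_nonneg.trans h])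
  rw [abs_of_nonneg h0] at h3
  have h4 := (le_abs_self _).trans h3
  rw [cosh_dist_re_im] at h1
  have h5 : ((z.re - w.re) ^ 2 + (z.im - w.im) ^ 2) / (2 * z.im * w.im) ≤ 4 * r ^ 2 := by
    linarith
  rw [div_le_iff₀ (by have := z.im_pos; have := w.im_pos; positivity)] at h5
  linarith

theorem dist_gridPoint_I_le {r : ℝ} (hr : 0 < r) {p : ℕ × ℕ} (h1 : 6 * r * p.1 ≤ 1)
    (h2 : 6 * r * p.2 ≤ 1) : dist (gridPoint r hr p) I ≤ 2 := by
  have h3 : Real.cosh (dist (gridPoint r hr p) I) ≤ 2 := by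
    have hy : 0 ≤ 6 * r * (p.2 : ℝ) := by positivity
    have hx : 0 ≤ 6 * r * (p.1 : ℝ) := by positivity
    rw [cosh_dist_re_im, gridPoint_re, gridPoint_im, I_re, I_im]
    have : ((6 * r * (p.1 : ℝ) - 0) ^ 2 + (1 + 6 * r * (p.2 : ℝ) - 1) ^ 2) /
        (2 * (1 + 6 * r * (p.2 : ℝ)) * 1) ≤ 1 := by
      rw [div_le_one (by positivity)]
      nlinarith
    linarith
  have h4 := Real.self_le_sinh_iff.2 (dist_nonneg (x := gridPoint r hr p) (y := I))
  nlinarith [Real.cosh_sq (dist (gridPoint r hr p) I),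
    Real.one_le_cosh (dist (gridPoint r hr p) I)]

theorem lt_dist_gridPoint {r : ℝ} (hr : 0 < r) (hr1 : r ≤ 1 / 2) {p q : ℕ × ℕ} (hpq : p ≠ q)
    (hp : 6 * r * p.2 ≤ 1) (hq : 6 * r * q.2 ≤ 1) :
    2 * r < dist (gridPoint r hr p) (gridPoint r hr q) := by
  by_contra! h
  have h1 := euclidean_sq_le_of_dist_le hr1 h
  simp only [gridPoint_re, gridPoint_im] at h1
  have h2 : (1 + 6 * r * (p.2 : ℝ)) * (1 + 6 * r * (q.2 : ℝ)) ≤ 2 * 2 :=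
    mul_le_mul (by linarith) (by linarith) (by positivity) (by norm_num)
  have h3 : (1 : ℝ) ≤ ((p.1 : ℝ) - q.1) ^ 2 + ((p.2 : ℝ) - q.2) ^ 2 := by
    have h4 : (1 : ℤ) ≤ ((p.1 : ℤ) - q.1) ^ 2 + ((p.2 : ℤ) - q.2) ^ 2 := by
      by_contra! h5
      have h6 : ((p.1 : ℤ) - q.1) ^ 2 = 0 := by
        nlinarith [sq_nonneg ((p.2 : ℤ) - q.2), sq_nonneg ((p.1 : ℤ) - q.1)]
      have h7 : ((p.2 : ℤ) - q.2) ^ 2 = 0 := by nlinarith [sq_nonneg ((p.2 : ℤ) - q.2)]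
      rw [sq_eq_zero_iff] at h6 h7
      exact hpq (Prod.ext (by lia) (by lia))
    exact_mod_cast h4
  have h8 : 0 < r ^ 2 := by positivity
  nlinarith [mul_le_mul_of_nonneg_left h2 h8.le, mul_le_mul_of_nonneg_left h3 h8.le]

/-- Packing bound: a ball of radius `r` has Haar measure `O(r ^ 2)` for bounded `r`. -/
theorem measureReal_orbitBall_le [MeasurableSpace SL(2, ℝ)] [BorelSpace SL(2, ℝ)]
    (μ : Measure SL(2, ℝ)) [μ.IsHaarMeasure] {r : ℝ} (hr : 0 < r) (hr3 : r ≤ 3) (z : ℍ) :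
    μ.real (orbitBall z r) ≤ 144 * μ.real (orbitBall I 3) * r ^ 2 := by
  rw [measureReal_orbitBall_eq]
  have hfin : μ (orbitBall I 3) ≠ ⊤ := (isCompact_orbitBall I 3).measure_ne_top
  have hM : 0 ≤ μ.real (orbitBall I 3) := measureReal_nonneg
  rcases le_total (1 / 6) r with h | h
  · have h1 : μ.real (orbitBall I r) ≤ μ.real (orbitBall I 3) :=
      measureReal_mono (orbitBall_mono I hr3) hfin
    nlinarith [mul_le_mul_of_nonneg_left (pow_le_pow_left₀ (by norm_num) h 2) hM]
  · set N := ⌊1 / (6 * r)⌋₊ with hN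
    have hx : 1 ≤ 1 / (6 * r) := by rw [le_div_iff₀ (by positivity)]; linarith
    have hN1 : 1 ≤ N := Nat.le_floor (by simpa using hx)
    have hN2 : 6 * r * N ≤ 1 := by
      have := Nat.floor_le (zero_le_one.trans hx)
      rwa [le_div_iff₀ (by positivity), mul_comm] at this
    have hN3 : 1 ≤ 12 * r * N := by
      have h1 := Nat.lt_floor_add_one (1 / (6 * r))
      rw [div_lt_iff₀ (by positivity), ← hN] at h1
      have h2 : (1 : ℝ) ≤ N := by exact_mod_cast hN1
      nlinarith
    have hle : ∀ k < N, 6 * r * (k : ℝ) ≤ 1 := fun k hk ↦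
      (mul_le_mul_of_nonneg_left (by exact_mod_cast hk.le) (by positivity)).trans hN2
    have key : ∑ p ∈ Finset.range N ×ˢ Finset.range N, μ.real (orbitBall (gridPoint r hr p) r) ≤
        μ.real (orbitBall I 3) := by
      rw [← measureReal_biUnion_finset _ (fun p _ ↦ measurableSet_orbitBall _ _)
        (fun p _ ↦ (isCompact_orbitBall _ _).measure_ne_top)]
      · refine measureReal_mono (iUnion₂_subset fun p hp g hg ↦ ?_) hfin
        simp only [Finset.mem_product, Finset.mem_range] at hp
        calc dist (g • I) I ≤ dist (g • I) (gridPoint r hr p) + dist (gridPoint r hr p) I :=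
              dist_triangle _ _ _
          _ ≤ r + 2 := add_le_add hg (dist_gridPoint_I_le hr (hle _ hp.1) (hle _ hp.2))
          _ ≤ 3 := by linarith
      · intro p hp q hq hpq
        simp only [Finset.coe_product, Set.mem_prod, Finset.mem_coe, Finset.mem_range] at hp hq
        refine Set.disjoint_left.2 fun g hgp hgq ↦ ?_
        have h1 := lt_dist_gridPoint hr (by linarith) hpq (hle _ hp.2) (hle _ hq.2)
        have h2 := dist_triangle_left (gridPoint r hr p) (gridPoint r hr q) (g • I)
        have h3 : dist (g • I) (gridPoint r hr p) ≤ r := hgp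
        have h4 : dist (g • I) (gridPoint r hr q) ≤ r := hgq
        linarith
    simp only [measureReal_orbitBall_eq, Finset.sum_const, Finset.card_product, Finset.card_range,
      nsmul_eq_mul, Nat.cast_mul] at key
    have hB : 0 ≤ μ.real (orbitBall I r) := measureReal_nonneg
    calc μ.real (orbitBall I r) ≤ (12 * r * N) ^ 2 * μ.real (orbitBall I r) :=
          le_mul_of_one_le_left hB (one_le_pow₀ hN3)
      _ = 144 * r ^ 2 * (N * N * μ.real (orbitBall I r)) := by ring
      _ ≤ 144 * r ^ 2 * μ.real (orbitBall I 3) := by gcongr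
      _ = _ := by ring

/-- For elliptic `γ` with fixed point `z₀`, the displacement at `w` in terms of `dist w z₀`. -/
theorem exists_cosh_half_displacement_eq (γ : SL(2, ℝ))
    (hγ : |Matrix.trace (γ : Matrix (Fin 2) (Fin 2) ℝ)| < 2) :
    ∃ z₀ : ℍ, ∀ w : ℍ, Real.cosh (dist (γ • w) w / 2) ^ 2 =
      1 + (1 - Matrix.trace (γ : Matrix (Fin 2) (Fin 2) ℝ) ^ 2 / 4) *
        Real.sinh (dist w z₀) ^ 2 := by
  have hdet := γ.det_coe
  rw [Matrix.det_fin_two] at hdet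
  rw [Matrix.trace_fin_two] at hγ ⊢
  set a := γ 0 0
  set b := γ 0 1
  set c := γ 1 0
  set d := γ 1 1
  have ht : (a + d) ^ 2 < 4 := by
    have := sq_lt_sq' (abs_lt.1 hγ).1 (abs_lt.1 hγ).2
    linarith
  have hc : c ≠ 0 := by
    intro hc
    rw [hc] at hdet
    nlinarith [sq_nonneg (a - d)]
  obtain ⟨y₀, hy₀, hcy⟩ : ∃ y₀ > 0, 4 * c ^ 2 * y₀ ^ 2 = 4 - (a + d) ^ 2 := by
    refine ⟨√(4 - (a + d) ^ 2) / (2 * |c|), ?_, ?_⟩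
    · have := Real.sqrt_pos.2 (sub_pos.2 ht)
      positivity
    · rw [div_pow, Real.sq_sqrt (sub_pos.2 ht).le, mul_pow, sq_abs]
      field_simp
      ring
  obtain ⟨x₀, hx₀⟩ : ∃ x₀, d = a - 2 * c * x₀ := ⟨(a - d) / (2 * c), by field_simp; ring⟩
  have hb : b = -c * (x₀ ^ 2 + y₀ ^ 2) := by
    apply mul_right_cancel₀ hc
    rw [hx₀] at hdet hcy
    linarith
  refine ⟨⟨⟨x₀, y₀⟩, hy₀⟩, fun w ↦ ?_⟩
  have hy := w.im_pos
  have hden : (c : ℂ) * w + d ≠ 0 := by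
    intro h
    have him := congrArg Complex.im h
    simp at him
    exact him.elim hc hy.ne'
  have hsmul : ((γ • w : ℍ) : ℂ) = (a * w + b) / (c * w + d) :=
    coe_specialLinearGroup_apply γ w
  have hsub : ((γ • w : ℍ) : ℂ) - w = -(c * w ^ 2 + (d - a) * w - b) / (c * w + d) := by
    rw [hsmul, eq_div_iff hden, sub_mul, div_mul_cancel₀ _ hden]
    ring
  have hN : 0 < Complex.normSq (c * w + d) := Complex.normSq_pos.2 hden
  have him : (γ • w).im = w.im / Complex.normSq (c * w + d) := by
    rw [← coe_im, hsmul, Complex.div_im]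
    simp
    field_simp
    linear_combination hdet
  have hcosh : Real.cosh (dist (γ • w) w) =
      1 + Complex.normSq (c * w ^ 2 + (d - a) * w - b) / (2 * w.im ^ 2) := by
    rw [cosh_dist, Complex.dist_eq, ← Complex.normSq_eq_norm_sq, hsub, Complex.normSq_div,
      Complex.normSq_neg, him]
    field_simp
  have hQ : Complex.normSq (c * w ^ 2 + (d - a) * w - b) =
      c ^ 2 * (((w.re - x₀) ^ 2 + w.im ^ 2 + y₀ ^ 2) ^ 2 - 4 * w.im ^ 2 * y₀ ^ 2) := by
    rw [hb, hx₀, Complex.normSq_apply]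
    simp [pow_two]
    ring
  have hhalf : Real.cosh (dist (γ • w) w / 2) ^ 2 = (Real.cosh (dist (γ • w) w) + 1) / 2 := by
    have := Real.cosh_two_mul (dist (γ • w) w / 2)
    rw [mul_div_cancel₀ _ two_ne_zero, Real.sinh_sq] at this
    linarith
  rw [hhalf, hcosh, hQ, Real.sinh_sq, cosh_dist_re_im,
    show 1 - (a + d) ^ 2 / 4 = c ^ 2 * y₀ ^ 2 by linarith]
  simp only [mk_re, mk_im]
  field_simp
  ring

theorem Hdisp_conj (γ g : SL(2, ℝ)) : Hdisp (g⁻¹ * γ * g) = dist (γ • g • I) (g • I) := by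
  rw [Hdisp, ← dist_smul g, smul_smul, smul_smul]
  congr 2
  group

theorem log_le_two_mul_sqrt {x : ℝ} (hx : 0 < x) : Real.log x ≤ 2 * √x := by
  have := Real.log_le_sub_one_of_pos (Real.sqrt_pos.2 hx)
  rw [Real.log_sqrt hx.le] at this
  linarith

theorem cosh_half_Hdisp_rpow_le {γ : SL(2, ℝ)} {m : ℕ} (hm : 2 ≤ m)
    (hγ : |Matrix.trace (γ : Matrix (Fin 2) (Fin 2) ℝ)| < 2 - 1 / √m) :
    ∃ z₀ : ℍ, ∀ g ∉ orbitBall z₀ √(4 * (Real.log m / √m)),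
      Real.cosh (Hdisp (g⁻¹ * γ * g) / 2) ^ (-(2 * (m : ℝ))) ≤ 1 / m := by
  have hm0 : (0 : ℝ) < m := by positivity
  have hs : 0 < √(m : ℝ) := Real.sqrt_pos.2 hm0
  have hlog : 0 ≤ Real.log m := Real.log_natCast_nonneg m
  have hinv : 0 < 1 / √(m : ℝ) := by positivity
  obtain ⟨z₀, hz⟩ := exists_cosh_half_displacement_eq γ (hγ.trans (by linarith))
  set t := Matrix.trace (γ : Matrix (Fin 2) (Fin 2) ℝ)
  refine ⟨z₀, fun g hg ↦ ?_⟩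
  have hD : 4 * (Real.log m / √m) ≤ dist (g • I) z₀ ^ 2 :=
    (Real.sqrt_le_left dist_nonneg).1 (not_le.1 hg).le
  have hsinh : dist (g • I) z₀ ^ 2 ≤ Real.sinh (dist (g • I) z₀) ^ 2 :=
    pow_le_pow_left₀ dist_nonneg (Real.self_le_sinh_iff.2 dist_nonneg) 2
  have ht : 1 / (2 * √m) ≤ 1 - t ^ 2 / 4 := by
    have h1 : 1 / (2 * √(m : ℝ)) = 1 / √m / 2 := by field_simp
    rw [h1, ← sq_abs t]
    nlinarith [abs_nonneg t]
  have hexp : Real.exp (Real.log m / m) ≤ 1 + 2 * (Real.log m / m) := by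
    have h0 : 0 ≤ Real.log m / m := by positivity
    have h1 : Real.log m / m ≤ 1 := by
      rw [div_le_one hm0]
      linarith [Real.log_le_sub_one_of_pos hm0]
    have h2 := Real.abs_exp_sub_one_le (x := Real.log m / m) (by rwa [abs_of_nonneg h0])
    rw [abs_of_nonneg h0] at h2
    linarith [le_abs_self (Real.exp (Real.log m / m) - 1)]
  have hcosh : Real.exp (Real.log m / m) ≤ Real.cosh (Hdisp (g⁻¹ * γ * g) / 2) ^ 2 := by
    rw [Hdisp_conj, hz]
    have h1 := mul_le_mul ht (hD.trans hsinh) (by positivity) (le_trans (by positivity) ht)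
    have h2 : 1 / (2 * √m) * (4 * (Real.log m / √m)) = 2 * (Real.log m / m) := by
      have := Real.mul_self_sqrt hm0.le
      field_simp
      linear_combination (-4 : ℝ) * Real.log m * this
    linarith
  rw [Real.rpow_neg (Real.cosh_pos _).le, Real.rpow_mul (Real.cosh_pos _).le, Real.rpow_natCast,
    Real.rpow_two, one_div]
  gcongr
  calc (m : ℝ) = Real.exp (Real.log m / m) ^ m := by
        rw [← Real.exp_nat_mul, mul_div_cancel₀ _ hm0.ne', Real.exp_log hm0]
    _ ≤ _ := by gcongr

theorem cosh_half_Hdisp_rpow_le_one (g : SL(2, ℝ)) (m : ℕ) :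
    Real.cosh (Hdisp g / 2) ^ (-(2 * (m : ℝ))) ≤ 1 :=
  Real.rpow_le_one_of_one_le_of_nonpos (Real.one_le_cosh _) (by simp)

end

/-- Let `μ` be a Haar measure on `G = SL(2,ℝ)`.  There is a constant
`C > 0` (depending only on the normalization of `μ`) such that for every integer `m ≥ 2`,
every compact `Ω ⊂ G` and every `γ ∈ G` with `|Tr(γ)| < 2 − 1/√m`, one has
`∫_Ω cosh(H(g⁻¹γg)/2)^(−2m) dμ(g) ≤ C·(log m/√m + μ(Ω)/m)`.  (The integrand is
`|Φ_m(g⁻¹γg)|` for the weight-`m` spherical function `Φ_m` with Casimir eigenvalue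
`m(1−m)`.) -/
theorem stmt_11 [MeasurableSpace SL(2, ℝ)] [BorelSpace SL(2, ℝ)]
    (μ : Measure SL(2, ℝ)) [μ.IsHaarMeasure] :
    ∃ C > (0 : ℝ), ∀ m : ℕ, 2 ≤ m → ∀ Ω : Set SL(2, ℝ), IsCompact Ω →
      ∀ γ : SL(2, ℝ),
        |Matrix.trace (γ : Matrix (Fin 2) (Fin 2) ℝ)| < 2 - 1 / Real.sqrt m →
        (∫ g in Ω, Real.cosh (Hdisp (g⁻¹ * γ * g) / 2) ^ (-(2 * (m : ℝ))) ∂μ) ≤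
          C * (Real.log m / Real.sqrt m + (μ Ω).toReal / m) := by
  have hfin : ∀ (z : UpperHalfPlane) (r : ℝ), μ (orbitBall z r) ≠ ⊤ := fun z r ↦
    (isCompact_orbitBall z r).measure_ne_top
  set M := μ.real (orbitBall UpperHalfPlane.I 3)
  have hM : 0 ≤ M := measureReal_nonneg
  refine ⟨576 * M + 1, by positivity, fun m hm Ω hΩ γ hγ ↦ ?_⟩
  obtain ⟨z₀, hz₀⟩ := cosh_half_Hdisp_rpow_le hm hγ
  have hm0 : (0 : ℝ) < m := by positivity
  have hlog : 0 < Real.log m := Real.log_pos (by exact_mod_cast hm)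
  set L := Real.log m / √m with hL
  have hL0 : 0 < L := by positivity
  have hL2 : L ≤ 2 := (div_le_iff₀ (Real.sqrt_pos.2 hm0)).2 (log_le_two_mul_sqrt hm0)
  set A := orbitBall z₀ √(4 * L)
  have hA : μ.real A ≤ 576 * M * L := by
    have h := measureReal_orbitBall_le μ (r := √(4 * L)) (Real.sqrt_pos.2 (by positivity))
      (Real.sqrt_le_iff.2 ⟨by norm_num, by linarith⟩) z₀
    rw [Real.sq_sqrt (by positivity)] at h
    linarith
  have hAm : MeasurableSet A := measurableSet_orbitBall _ _
  have hA1 : Integrable (A.indicator fun _ ↦ (1 : ℝ)) (μ.restrict Ω) :=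
    ((integrable_indicator_iff hAm).2 (integrableOn_const (hfin _ _))).restrict
  have hΩ1 : Integrable (fun _ ↦ 1 / (m : ℝ)) (μ.restrict Ω) :=
    integrableOn_const hΩ.measure_ne_top
  calc _ ≤ ∫ g in Ω, (A.indicator (fun _ ↦ (1 : ℝ)) g + 1 / m) ∂μ := by
        refine integral_mono_of_nonneg (.of_forall fun g ↦ ?_) (hA1.add hΩ1)
          (.of_forall fun g ↦ ?_)
        · exact (Real.rpow_pos_of_pos (Real.cosh_pos _) _).le
        · by_cases hg : g ∈ A
          · have := cosh_half_Hdisp_rpow_le_one (g⁻¹ * γ * g) m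
            have : 0 ≤ 1 / (m : ℝ) := by positivity
            simp only [Set.indicator_of_mem hg]
            linarith
          · simpa [Set.indicator_of_notMem hg] using hz₀ g hg
    _ = μ.real (A ∩ Ω) + μ.real Ω / m := by
        rw [integral_add hA1 hΩ1, integral_indicator_const _ hAm, setIntegral_const,
          measureReal_restrict_apply hAm]
        simp [div_eq_mul_inv]
    _ ≤ μ.real A + μ.real Ω / m := by
        gcongr
        · exact hfin _ _
        · exact Set.inter_subset_left
    _ ≤ (576 * M + 1) * (L + μ.real Ω / m) := by
        have : 0 ≤ μ.real Ω / m := by positivity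
        nlinarith [mul_nonneg hM this]
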